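/- arXiv:1401.3114 — 10 statements merged into one kernel-verified Lean document; each statement's English description precedes it below -/
import Mathlib

section
/- Let V : S^{m-1} → S^{m-1} be a quadratic stochastic operator with heredity coefficients P_{ij,k}. Then the following are equivalent: (i) V is a Volterra QSO, i.e. P_{ij,k} = 0 whenever k ∉ {i,j}; (ii) V(x) is absolutely continuous with respect to x (V(x) ≺ x) for every x ∈ S^{m-1}. -/
open Finset

/-- Let `V : S^{m-1} → S^{m-1}` be a quadratic stochastic operator with
heredity coefficients `P i j k`.  Then `V` is Volterra (i.e. `P i j k = 0` whenever
`k ∉ {i, j}`) if and only if `V x ≺ x` (absolute continuity: `x k = 0 → (V x) k = 0`)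
for every `x` in the simplex `S^{m-1}`. -/
theorem volterra_iff_absolutely_continuous
    (m : ℕ) (P : Fin m → Fin m → Fin m → ℝ)
    (hP0 : ∀ i j k, 0 ≤ P i j k)
    (hPsym : ∀ i j k, P i j k = P j i k)
    (hPsum : ∀ i j, ∑ k, P i j k = 1)
    (V : (Fin m → ℝ) → (Fin m → ℝ))
    (hV : ∀ x k, V x k = ∑ i, ∑ j, P i j k * x i * x j) :
    (∀ i j k, k ≠ i → k ≠ j → P i j k = 0) ↔
      (∀ x : Fin m → ℝ, (∀ i, 0 ≤ x i) → ∑ i, x i = 1 →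
        ∀ k, x k = 0 → V x k = 0) := by
  constructor
  · intro h x _ _ k hk
    rw [hV]
    refine Finset.sum_eq_zero fun i _ => Finset.sum_eq_zero fun j _ => ?_
    by_cases hi : k = i
    · subst hi
      simp [hk]
    by_cases hj : k = j
    · subst hj
      simp [hk]
    simp [h i j k hi hj]
  · intro h i j k hi hj
    -- test the hypothesis at the midpoint of the vertices `i` and `j`
    let x : Fin m → ℝ := fun l => (if l = i then 1 / 2 else 0) + (if l = j then 1 / 2 else 0)
    have hx0 : ∀ l, 0 ≤ x l := by
      intro l
      simp only [x]
      positivity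
    have hxs : ∑ l, x l = 1 := by
      simp only [x, Finset.sum_add_distrib, Finset.sum_ite_eq', Finset.mem_univ, if_true]
      norm_num
    have hxk : x k = 0 := by simp [x, hi, hj]
    have hxi : 0 < x i := by
      simp only [x, if_true]
      positivity
    have hxj : 0 < x j := by
      simp only [x, if_true]
      positivity
    have hz := h x hx0 hxs k hxk
    rw [hV] at hz
    have hterm : ∀ a b, 0 ≤ P a b k * x a * x b := fun a b =>
      mul_nonneg (mul_nonneg (hP0 a b k) (hx0 a)) (hx0 b)
    have h1 := (Finset.sum_eq_zero_iff_of_nonneg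
      (fun a _ => Finset.sum_nonneg fun b _ => hterm a b)).1 hz i (Finset.mem_univ i)
    have h2 := (Finset.sum_eq_zero_iff_of_nonneg
      (fun b _ => hterm i b)).1 h1 j (Finset.mem_univ j)
    simpa [hxi.ne', hxj.ne'] using h2
end

section
/- Let V : S^{m-1} → S^{m-1} be a quadratic stochastic operator with heredity coefficients P_{ij,k}, and suppose V(x) ≺ x for all x ∈ S^{m-1}. Then P_{ij,k} = 0 for all i, j, k with k ∉ {i,j}; that is, V is a Volterra QSO. -/
open Finset

/-- Let `V : S^{m-1} → S^{m-1}` be a quadratic stochastic operator with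
heredity coefficients `P i j k`, and suppose `V x ≺ x` for all `x ∈ S^{m-1}`.
Then `P i j k = 0` whenever `k ∉ {i, j}`, i.e. `V` is a Volterra QSO. -/
theorem volterra_of_absolutely_continuous
    (m : ℕ) (P : Fin m → Fin m → Fin m → ℝ)
    (hP0 : ∀ i j k, 0 ≤ P i j k)
    (hPsym : ∀ i j k, P i j k = P j i k)
    (hPsum : ∀ i j, ∑ k, P i j k = 1)
    (V : (Fin m → ℝ) → (Fin m → ℝ))
    (hV : ∀ x k, V x k = ∑ i, ∑ j, P i j k * x i * x j)
    (hprec : ∀ x : Fin m → ℝ, (∀ i, 0 ≤ x i) → ∑ i, x i = 1 →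
      ∀ k, x k = 0 → V x k = 0) :
    ∀ i j k : Fin m, k ≠ i → k ≠ j → P i j k = 0 := by
  intro i j k hi hj
  let x : Fin m → ℝ := fun l => (if l = i then 1/2 else 0) + (if l = j then 1/2 else 0)
  have hx0 : ∀ l, 0 ≤ x l := by
    intro l
    dsimp only [x]
    split_ifs <;> norm_num
  have hx1 : ∑ l, x l = 1 := by
    simp only [x, Finset.sum_add_distrib, Finset.sum_ite_eq', Finset.mem_univ, if_true]
    norm_num
  have hxk : x k = 0 := by simp [x, hi, hj]
  have h := hprec x hx0 hx1 k hxk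
  rw [hV] at h
  have hn : ∀ a b, 0 ≤ P a b k * x a * x b := fun a b =>
    mul_nonneg (mul_nonneg (hP0 a b k) (hx0 a)) (hx0 b)
  have h1 := (Finset.sum_eq_zero_iff_of_nonneg
    (fun a _ => Finset.sum_nonneg (fun b _ => hn a b))).1 h i (Finset.mem_univ i)
  have h2 := (Finset.sum_eq_zero_iff_of_nonneg (fun b _ => hn i b)).1 h1 j (Finset.mem_univ j)
  have hxi : 0 < x i := by
    dsimp only [x]
    split_ifs <;> simp_all
  have hxj : 0 < x j := by
    dsimp only [x]
    split_ifs <;> simp_all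
  rcases mul_eq_zero.1 h2 with h3 | h3
  · rcases mul_eq_zero.1 h3 with h4 | h4
    · exact h4
    · exact absurd h4 hxi.ne'
  · exact absurd h3 hxj.ne'
end

section
/- Let (E,𝓕) be a measurable space and V the QSO on probability measures defined by the kernel P. Then V is Volterra (i.e. V(λ) is absolutely continuous with respect to λ for every probability measure λ) if and only if P(x,y,A) = 0 for all A ∈ 𝓕 and all x, y ∉ A. -/
open MeasureTheory

/-- Let `(E, 𝓕)` be a measurable space and `V` the quadratic stochastic
operator on probability measures defined by the kernel `P`, i.e.
`V λ A = ∫∫ P x y A dλ(x) dλ(y)`.  Then `V` is Volterra (i.e. `V λ` is absolutely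
continuous with respect to `λ` for every probability measure `λ`) if and only if
`P x y A = 0` for every `A ∈ 𝓕` and all `x, y ∉ A`. -/
theorem measureVolterra_iff_kernel_vanishes
    {E : Type*} [MeasurableSpace E]
    (P : E → E → Measure E)
    (hProb : ∀ x y, IsProbabilityMeasure (P x y))
    (hMeas : ∀ A : Set E, MeasurableSet A →
      Measurable (fun p : E × E => P p.1 p.2 A))
    (hSym : ∀ x y, P x y = P y x)
    (V : Measure E → Measure E)
    (hV : ∀ lam : Measure E, IsProbabilityMeasure lam →
      ∀ A : Set E, MeasurableSet A →
        V lam A = ∫⁻ x, ∫⁻ y, P x y A ∂lam ∂lam) :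
    (∀ lam : Measure E, IsProbabilityMeasure lam →
        ∀ A : Set E, MeasurableSet A → lam A = 0 → V lam A = 0) ↔
      (∀ A : Set E, MeasurableSet A → ∀ x y : E, x ∉ A → y ∉ A → P x y A = 0) := by
  constructor
  · intro h A hA x y hx hy
    let lam : Measure E := (2⁻¹ : ENNReal) • Measure.dirac x + (2⁻¹ : ENNReal) • Measure.dirac y
    have hlam : IsProbabilityMeasure lam := ⟨by
      simp [lam, ENNReal.inv_two_add_inv_two]⟩
    have h0 : lam A = 0 := by
      simp [lam, Measure.dirac_apply' _ hA, hx, hy]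
    have h1 := h lam hlam A hA h0
    rw [hV lam hlam A hA] at h1
    have hm : Measurable (fun a => ∫⁻ b, P a b A ∂lam) :=
      (hMeas A hA).lintegral_prod_right'
    have hm2 : Measurable (fun b => P x b A) :=
      (hMeas A hA).comp measurable_prodMk_left
    have key : ∀ f : E → ENNReal, Measurable f → ∫⁻ a, f a ∂lam = 0 → f x = 0 ∧ f y = 0 := by
      intro f hf hf0
      simpa [lam, lintegral_add_measure, lintegral_smul_measure, lintegral_dirac' _ hf] using hf0
    exact (key _ hm2 (key _ hm h1).1).2
  · intro h lam hlam A hA h0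
    rw [hV lam hlam A hA]
    have hae : ∀ᵐ x ∂lam, x ∉ A := measure_eq_zero_iff_ae_notMem.mp h0
    refine lintegral_eq_zero_of_ae_eq_zero ?_
    filter_upwards [hae] with x hx
    refine lintegral_eq_zero_of_ae_eq_zero ?_
    filter_upwards [hae] with y hy
    exact h A hA x y hx hy
end

section
/- Let (E,𝓕) be a measurable space and V the QSO on probability measures defined by the kernel P. If V is Volterra, then for every A ∈ 𝓕 and every x, y ∈ E with x ∉ A and y ∉ A one has P(x,x,A) = P(y,y,A) = P(x,y,A) = 0. In particular, applying V to the measure ν = (δ_x + δ_y)/2 gives V(ν)(A) = (P(x,x,A) + P(y,y,A) + 2P(x,y,A))/4. -/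
open MeasureTheory ENNReal

/-- Let `(E, 𝓕)` be a measurable space and `V` the quadratic stochastic
operator on probability measures defined by the kernel `P`.  If `V` is Volterra, then for
every `A ∈ 𝓕` and all `x, y ∉ A` one has `P x x A = P y y A = P x y A = 0`;  in
particular, applying `V` to the measure `ν = (δ_x + δ_y) / 2` gives
`V ν A = (P x x A + P y y A + 2 * P x y A) / 4`. -/
theorem kernel_vanishes_of_measureVolterra
    {E : Type*} [MeasurableSpace E]
    (P : E → E → Measure E)
    (hProb : ∀ x y, IsProbabilityMeasure (P x y))
    (hMeas : ∀ A : Set E, MeasurableSet A →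
      Measurable (fun p : E × E => P p.1 p.2 A))
    (hSym : ∀ x y, P x y = P y x)
    (V : Measure E → Measure E)
    (hV : ∀ lam : Measure E, IsProbabilityMeasure lam →
      ∀ A : Set E, MeasurableSet A →
        V lam A = ∫⁻ x, ∫⁻ y, P x y A ∂lam ∂lam)
    (hVolterra : ∀ lam : Measure E, IsProbabilityMeasure lam →
      ∀ A : Set E, MeasurableSet A → lam A = 0 → V lam A = 0) :
    ∀ A : Set E, MeasurableSet A → ∀ x y : E, x ∉ A → y ∉ A →
      P x x A = 0 ∧ P y y A = 0 ∧ P x y A = 0 ∧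
        V ((2 : ℝ≥0∞)⁻¹ • (Measure.dirac x + Measure.dirac y)) A =
          (P x x A + P y y A + 2 * P x y A) / 4 := by
  intro A hA x y hx hy
  have hpr : IsProbabilityMeasure
      ((2 : ℝ≥0∞)⁻¹ • (Measure.dirac x + Measure.dirac y) : Measure E) := by
    constructor
    simp only [Measure.smul_apply, Measure.add_apply, measure_univ, smul_eq_mul]
    rw [one_add_one_eq_two]
    exact ENNReal.inv_mul_cancel (by simp) (by simp)
  have h0 := hVolterra _ hpr A hA (by
    simp [Measure.dirac_apply' _ hA, hx, hy])
  have h1 := h0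
  have hm := hMeas A hA
  have hm1 : ∀ a, Measurable (fun b => P a b A) := fun a =>
    hm.comp (measurable_const.prodMk measurable_id)
  have hm2 : ∀ b, Measurable (fun a => P a b A) := fun b =>
    hm.comp (measurable_id.prodMk measurable_const)
  rw [hV _ hpr A hA] at h1
  have hin : ∀ a, ∫⁻ b, P a b A ∂((2 : ℝ≥0∞)⁻¹ • (Measure.dirac x + Measure.dirac y)) =
      2⁻¹ * (P a x A + P a y A) := by
    intro a
    rw [lintegral_smul_measure, lintegral_add_measure, lintegral_dirac' _ (hm1 a),
      lintegral_dirac' _ (hm1 a), smul_eq_mul]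
  have hmo : Measurable (fun a => (2 : ℝ≥0∞)⁻¹ * (P a x A + P a y A)) :=
    ((hm2 x).add (hm2 y)).const_mul _
  simp_rw [hin] at h1
  rw [lintegral_smul_measure, lintegral_add_measure, lintegral_dirac' _ hmo,
    lintegral_dirac' _ hmo, smul_eq_mul] at h1
  have h2 : (P x x A = 0 ∧ P x y A = 0) ∧ (P y x A = 0 ∧ P y y A = 0) := by
    simpa [mul_eq_zero, add_eq_zero] using h1
  obtain ⟨⟨hxx, hxy⟩, -, hyy⟩ := h2
  refine ⟨hxx, hyy, hxy, ?_⟩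
  rw [h0, hxx, hyy, hxy]
  simp
end

section
/- Let (E,𝓕) be a measurable space and V the QSO on probability measures defined by the kernel P. Suppose P(x,y,A) = 0 for all A ∈ 𝓕 and all x, y ∉ A. Then for every probability measure μ and every B ∈ 𝓕 with μ(B) = 0 one has V(μ)(B) = 0; that is, V is Volterra. -/
open MeasureTheory

/-- Let `(E, 𝓕)` be a measurable space and `V` the quadratic stochastic
operator on probability measures defined by the kernel `P`.  Suppose `P x y A = 0` for
all `A ∈ 𝓕` and all `x, y ∉ A`.  Then for every probability measure `μ` and every
`B ∈ 𝓕` with `μ B = 0` one has `V μ B = 0`; that is, `V` is Volterra. -/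
theorem measureVolterra_of_kernel_vanishes
    {E : Type*} [MeasurableSpace E]
    (P : E → E → Measure E)
    (hProb : ∀ x y, IsProbabilityMeasure (P x y))
    (hMeas : ∀ A : Set E, MeasurableSet A →
      Measurable (fun p : E × E => P p.1 p.2 A))
    (hSym : ∀ x y, P x y = P y x)
    (V : Measure E → Measure E)
    (hV : ∀ lam : Measure E, IsProbabilityMeasure lam →
      ∀ A : Set E, MeasurableSet A →
        V lam A = ∫⁻ x, ∫⁻ y, P x y A ∂lam ∂lam)
    (hKer : ∀ A : Set E, MeasurableSet A → ∀ x y : E, x ∉ A → y ∉ A → P x y A = 0) :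
    ∀ μ : Measure E, IsProbabilityMeasure μ →
      ∀ B : Set E, MeasurableSet B → μ B = 0 → V μ B = 0 := by
  intro μ hμ B hB h0
  rw [hV μ hμ B hB]
  have hae : ∀ᵐ x ∂μ, x ∉ B := measure_eq_zero_iff_ae_notMem.mp h0
  have h1 : ∀ᵐ x ∂μ, ∫⁻ y, P x y B ∂μ = 0 := by
    filter_upwards [hae] with x hx
    have h2 : ∀ᵐ y ∂μ, P x y B = 0 := by
      filter_upwards [hae] with y hy
      exact hKer B hB x y hx hy
    rw [lintegral_congr_ae h2, lintegral_zero]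
  rw [lintegral_congr_ae h1, lintegral_zero]
end

section
/- Let V : S² → S² be an orthogonal preserving QSO. Then the images V(e₁), V(e₂), V(e₃) of the three vertices form a permutation of the vertices {e₁, e₂, e₃}; that is, there is a permutation σ of {1,2,3} with V(e_k) = e_{σ(k)} for each k, and in particular the vector (P_{kk,1}, P_{kk,2}, P_{kk,3}) equals the vertex e_{σ(k)} for each k. -/
open Finset

/-- The two–dimensional simplex `S²` in `ℝ³`. -/
def S2 : Set (Fin 3 → ℝ) := {x | (∀ i, 0 ≤ x i) ∧ ∑ i, x i = 1}

/-- Orthogonality of vectors: disjoint supports. -/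
def Orth (x y : Fin 3 → ℝ) : Prop := {i | x i ≠ 0} ∩ {i | y i ≠ 0} = ∅

/-- The vertex `e k` of the simplex. -/
def vertex (k : Fin 3) : Fin 3 → ℝ := fun i => if i = k then 1 else 0

/-- Let `V : S² → S²` be an orthogonal preserving QSO with coefficients
`P i j k`.  Then the images of the three vertices form a permutation of the vertices:
there is a permutation `σ` of `{1,2,3}` with `V (e k) = e (σ k)` for each `k`, and in
particular the vector `(P k k 1, P k k 2, P k k 3)` equals the vertex `e (σ k)`. -/
theorem orthogonal_preserving_permutes_vertices
    (P : Fin 3 → Fin 3 → Fin 3 → ℝ)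
    (hP0 : ∀ i j k, 0 ≤ P i j k)
    (hPsym : ∀ i j k, P i j k = P j i k)
    (hPsum : ∀ i j, ∑ k, P i j k = 1)
    (V : (Fin 3 → ℝ) → (Fin 3 → ℝ))
    (hV : ∀ x k, V x k = ∑ i, ∑ j, P i j k * x i * x j)
    (hOP : ∀ x ∈ S2, ∀ y ∈ S2, Orth x y → Orth (V x) (V y)) :
    ∃ σ : Equiv.Perm (Fin 3),
      (∀ k, V (vertex k) = vertex (σ k)) ∧
      (∀ k i, P k k i = vertex (σ k) i) := by
  have hVv : ∀ k i, V (vertex k) i = P k k i := by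
    intro k i
    rw [hV]
    simp [vertex]
  have hmem : ∀ k, vertex k ∈ S2 := by
    intro k
    refine ⟨fun i => ?_, by simp [vertex]⟩
    unfold vertex
    split_ifs <;> norm_num
  have hdis : ∀ k l, k ≠ l → ∀ i, P k k i ≠ 0 → P l l i ≠ 0 → False := by
    intro k l hkl i h1 h2
    have ho : Orth (vertex k) (vertex l) := by
      unfold Orth
      ext j
      simp only [vertex, Set.mem_inter_iff, Set.mem_setOf_eq, Set.mem_empty_iff_false, iff_false]
      rintro ⟨ha, hb⟩
      apply hkl
      have hjk : j = k := by
        by_contra h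
        simp [h] at ha
      have hjl : j = l := by
        by_contra h
        simp [h] at hb
      rw [← hjk, hjl]
    have h := hOP _ (hmem k) _ (hmem l) ho
    have hi : i ∈ ({i | V (vertex k) i ≠ 0} ∩ {i | V (vertex l) i ≠ 0} : Set (Fin 3)) := by
      constructor
      · simpa [hVv] using h1
      · simpa [hVv] using h2
    unfold Orth at h
    rw [h] at hi
    exact hi
  have hex : ∀ k, ∃ i, P k k i ≠ 0 := by
    intro k
    by_contra! h
    have := hPsum k k
    simp [h] at this
  choose s hs using hex
  have hinj : Function.Injective s := by
    intro k l hkl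
    by_contra hne
    exact hdis k l hne (s k) (hs k) (hkl ▸ hs l)
  have hbij : Function.Bijective s := Finite.injective_iff_bijective.mp hinj
  have hzero : ∀ k i, i ≠ s k → P k k i = 0 := by
    intro k i hi
    obtain ⟨l, rfl⟩ := hbij.2 i
    by_contra hne
    exact hdis k l (fun h => hi (h ▸ rfl)) (s l) hne (hs l)
  have hmain : ∀ k i, P k k i = vertex (s k) i := by
    intro k i
    unfold vertex
    split_ifs with h
    · rw [h, ← hPsum k k]
      exact (Finset.sum_eq_single (s k) (fun b _ hb => hzero k b hb) (by simp)).symm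
    · exact hzero k i h
  refine ⟨Equiv.ofBijective s hbij, fun k => ?_, fun k i => hmain k i⟩
  funext i
  rw [hVv]
  exact hmain k i
end

section
/- Let V : S² → S² be an orthogonal preserving QSO. Then there exist α, β, γ ∈ [0,1] such that V coincides on S² with one of the six operators V^{(1)}_{α,β,γ}, V^{(2)}_{α,β,γ}, V^{(3)}_{α,β,γ}, V^{(4)}_{α,β,γ}, V^{(5)}_{α,β,γ}, V^{(6)}_{α,β,γ}. -/
open Finset

/-- The operator `V⁽¹⁾_{α,β,γ}` on `S²`. -/
noncomputable def V1 (a b g : ℝ) (p : Fin 3 → ℝ) : Fin 3 → ℝ :=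
  ![p 2 ^ 2 + 2 * g * p 0 * p 2 + 2 * b * p 1 * p 2,
    p 1 ^ 2 + 2 * a * p 0 * p 1 + 2 * (1 - b) * p 1 * p 2,
    p 0 ^ 2 + 2 * (1 - a) * p 0 * p 1 + 2 * (1 - g) * p 0 * p 2]

/-- The operator `V⁽²⁾_{α,β,γ}` on `S²`. -/
noncomputable def V2 (a b g : ℝ) (p : Fin 3 → ℝ) : Fin 3 → ℝ :=
  ![p 0 ^ 2 + 2 * a * p 0 * p 1 + 2 * g * p 0 * p 2,
    p 1 ^ 2 + 2 * (1 - a) * p 0 * p 1 + 2 * b * p 1 * p 2,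
    p 2 ^ 2 + 2 * (1 - g) * p 0 * p 2 + 2 * (1 - b) * p 1 * p 2]

/-- The operator `V⁽³⁾_{α,β,γ}` on `S²`. -/
noncomputable def V3 (a b g : ℝ) (p : Fin 3 → ℝ) : Fin 3 → ℝ :=
  ![p 0 ^ 2 + 2 * a * p 0 * p 1 + 2 * g * p 0 * p 2,
    p 2 ^ 2 + 2 * (1 - g) * p 0 * p 2 + 2 * b * p 1 * p 2,
    p 1 ^ 2 + 2 * (1 - a) * p 0 * p 1 + 2 * (1 - b) * p 1 * p 2]

/-- The operator `V⁽⁴⁾_{α,β,γ}` on `S²`. -/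
noncomputable def V4 (a b g : ℝ) (p : Fin 3 → ℝ) : Fin 3 → ℝ :=
  ![p 1 ^ 2 + 2 * a * p 0 * p 1 + 2 * b * p 1 * p 2,
    p 2 ^ 2 + 2 * g * p 0 * p 2 + 2 * (1 - b) * p 1 * p 2,
    p 0 ^ 2 + 2 * (1 - a) * p 0 * p 1 + 2 * (1 - g) * p 0 * p 2]

/-- The operator `V⁽⁵⁾_{α,β,γ}` on `S²`. -/
noncomputable def V5 (a b g : ℝ) (p : Fin 3 → ℝ) : Fin 3 → ℝ :=
  ![p 1 ^ 2 + 2 * a * p 0 * p 1 + 2 * b * p 1 * p 2,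
    p 0 ^ 2 + 2 * (1 - a) * p 0 * p 1 + 2 * g * p 0 * p 2,
    p 2 ^ 2 + 2 * (1 - g) * p 0 * p 2 + 2 * (1 - b) * p 1 * p 2]

/-- The operator `V⁽⁶⁾_{α,β,γ}` on `S²`. -/
noncomputable def V6 (a b g : ℝ) (p : Fin 3 → ℝ) : Fin 3 → ℝ :=
  ![p 2 ^ 2 + 2 * g * p 0 * p 2 + 2 * b * p 1 * p 2,
    p 0 ^ 2 + 2 * a * p 0 * p 1 + 2 * (1 - g) * p 0 * p 2,
    p 1 ^ 2 + 2 * (1 - a) * p 0 * p 1 + 2 * (1 - b) * p 1 * p 2]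

lemma key_zero
    (P : Fin 3 → Fin 3 → Fin 3 → ℝ)
    (hP0 : ∀ i j k, 0 ≤ P i j k)
    (V : (Fin 3 → ℝ) → (Fin 3 → ℝ))
    (hV : ∀ x k, V x k = ∑ i, ∑ j, P i j k * x i * x j)
    (hOP : ∀ x ∈ S2, ∀ y ∈ S2, Orth x y → Orth (V x) (V y))
    (i j l k : Fin 3) (hil : i ≠ l) (hjl : j ≠ l) : P l l k ≠ 0 → P i j k = 0 := by
  intro h1
  by_contra h2
  have hx : (Pi.single l 1 : Fin 3 → ℝ) ∈ S2 := by
    refine ⟨fun m => ?_, by simp⟩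
    by_cases h : m = l <;> simp [Pi.single_apply, h]
  have hy : (Pi.single i (1/2) + Pi.single j (1/2) : Fin 3 → ℝ) ∈ S2 := by
    refine ⟨fun m => ?_, ?_⟩
    · simp only [Pi.add_apply, Pi.single_apply]
      split_ifs <;> norm_num
    · simp only [Pi.add_apply, Finset.sum_add_distrib, Finset.sum_pi_single']
      norm_num
  have ho : Orth (Pi.single l 1 : Fin 3 → ℝ)
      (Pi.single i (1/2) + Pi.single j (1/2) : Fin 3 → ℝ) := by
    ext m
    by_cases h : m = l
    · subst h
      simp [Pi.single_apply, hil.symm, hjl.symm]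
    · simp [Pi.single_apply, h]
  have h := hOP _ hx _ hy ho
  have hk : k ∈ ({m | V (Pi.single l 1) m ≠ 0} ∩
      {m | V (Pi.single i (1/2) + Pi.single j (1/2)) m ≠ 0} : Set (Fin 3)) := by
    constructor
    · simp only [Set.mem_setOf_eq, hV, Pi.single_apply]
      simpa using h1
    · simp only [Set.mem_setOf_eq, hV]
      have hpos : 0 < P i j k := lt_of_le_of_ne (hP0 i j k) (Ne.symm h2)
      apply ne_of_gt
      have hn : ∀ a b, 0 ≤ P a b k * (Pi.single i (1/2) + Pi.single j (1/2) : Fin 3 → ℝ) a *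
          (Pi.single i (1/2) + Pi.single j (1/2) : Fin 3 → ℝ) b := fun a b =>
        mul_nonneg (mul_nonneg (hP0 a b k) (hy.1 a)) (hy.1 b)
      refine Finset.sum_pos' (fun a _ => Finset.sum_nonneg fun b _ => hn a b)
        ⟨i, Finset.mem_univ _, Finset.sum_pos' (fun b _ => hn i b) ⟨j, Finset.mem_univ _, ?_⟩⟩
      refine mul_pos (mul_pos hpos ?_) ?_
      · simp only [Pi.add_apply, Pi.single_apply]
        split_ifs <;> norm_num at *
      · simp only [Pi.add_apply, Pi.single_apply]
        split_ifs <;> norm_num at *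
  have h' : k ∈ (∅ : Set (Fin 3)) := by
    rw [← h]
    exact hk
  exact h'

/-- The data of the operator once the vertex permutation `0 ↦ p, 1 ↦ q, 2 ↦ r` is known. -/
lemma key_facts
    (P : Fin 3 → Fin 3 → Fin 3 → ℝ)
    (hsum : ∀ i j (p q r : Fin 3), p ≠ q → p ≠ r → q ≠ r → P i j p + P i j q + P i j r = 1)
    (B : ∀ i j l k : Fin 3, i ≠ l → j ≠ l → P l l k ≠ 0 → P i j k = 0)
    (p q r : Fin 3) (hpq : p ≠ q) (hpr : p ≠ r) (hqr : q ≠ r)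
    (hp : P 0 0 p ≠ 0) (hq : P 1 1 q ≠ 0) (hr : P 2 2 r ≠ 0) :
    (P 0 0 p = 1 ∧ P 0 0 q = 0 ∧ P 0 0 r = 0) ∧
    (P 1 1 p = 0 ∧ P 1 1 q = 1 ∧ P 1 1 r = 0) ∧
    (P 2 2 p = 0 ∧ P 2 2 q = 0 ∧ P 2 2 r = 1) ∧
    (P 0 1 r = 0 ∧ P 0 1 q = 1 - P 0 1 p) ∧
    (P 0 2 q = 0 ∧ P 0 2 r = 1 - P 0 2 p) ∧
    (P 1 2 p = 0 ∧ P 1 2 r = 1 - P 1 2 q) := by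
  have a1 := B 0 0 1 q (by decide) (by decide) hq
  have a2 := B 0 0 2 r (by decide) (by decide) hr
  have a3 := B 1 1 0 p (by decide) (by decide) hp
  have a4 := B 1 1 2 r (by decide) (by decide) hr
  have a5 := B 2 2 0 p (by decide) (by decide) hp
  have a6 := B 2 2 1 q (by decide) (by decide) hq
  have a7 := B 0 1 2 r (by decide) (by decide) hr
  have a8 := B 0 2 1 q (by decide) (by decide) hq
  have a9 := B 1 2 0 p (by decide) (by decide) hp
  have s00 := hsum 0 0 p q r hpq hpr hqr
  have s11 := hsum 1 1 p q r hpq hpr hqr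
  have s22 := hsum 2 2 p q r hpq hpr hqr
  have s01 := hsum 0 1 p q r hpq hpr hqr
  have s02 := hsum 0 2 p q r hpq hpr hqr
  have s12 := hsum 1 2 p q r hpq hpr hqr
  refine ⟨⟨?_, ?_, ?_⟩, ⟨?_, ?_, ?_⟩, ⟨?_, ?_, ?_⟩, ⟨?_, ?_⟩, ⟨?_, ?_⟩, ?_, ?_⟩ <;> linarith

/-- Every orthogonal preserving QSO `V : S² → S²` coincides on `S²` with
one of the six operators `V⁽¹⁾_{α,β,γ}, …, V⁽⁶⁾_{α,β,γ}` for some `α, β, γ ∈ [0,1]`. -/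
theorem orthogonal_preserving_classification
    (P : Fin 3 → Fin 3 → Fin 3 → ℝ)
    (hP0 : ∀ i j k, 0 ≤ P i j k)
    (hPsym : ∀ i j k, P i j k = P j i k)
    (hPsum : ∀ i j, ∑ k, P i j k = 1)
    (V : (Fin 3 → ℝ) → (Fin 3 → ℝ))
    (hV : ∀ x k, V x k = ∑ i, ∑ j, P i j k * x i * x j)
    (hOP : ∀ x ∈ S2, ∀ y ∈ S2, Orth x y → Orth (V x) (V y)) :
    ∃ a b g : ℝ, a ∈ Set.Icc (0 : ℝ) 1 ∧ b ∈ Set.Icc (0 : ℝ) 1 ∧ g ∈ Set.Icc (0 : ℝ) 1 ∧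
      ((∀ x ∈ S2, V x = V1 a b g x) ∨ (∀ x ∈ S2, V x = V2 a b g x) ∨
       (∀ x ∈ S2, V x = V3 a b g x) ∨ (∀ x ∈ S2, V x = V4 a b g x) ∨
       (∀ x ∈ S2, V x = V5 a b g x) ∨ (∀ x ∈ S2, V x = V6 a b g x)) := by
  have B := key_zero P hP0 V hV hOP
  have hle : ∀ i j k, P i j k ∈ Set.Icc (0 : ℝ) 1 := fun i j k =>
    ⟨hP0 i j k, by
      rw [← hPsum i j]
      exact Finset.single_le_sum (fun m _ => hP0 i j m) (Finset.mem_univ k)⟩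
  have hsum : ∀ i j (p q r : Fin 3), p ≠ q → p ≠ r → q ≠ r →
      P i j p + P i j q + P i j r = 1 := by
    intro i j p q r h1 h2 h3
    have h := hPsum i j
    rw [Fin.sum_univ_three] at h
    fin_cases p <;> fin_cases q <;> fin_cases r <;> simp at h1 h2 h3 ⊢ <;> linarith
  have hex : ∀ i, ∃ k, P i i k ≠ 0 := by
    intro i
    by_contra! h
    have := hPsum i i
    simp [h] at this
  obtain ⟨p, hp⟩ := hex 0
  obtain ⟨q, hq⟩ := hex 1
  obtain ⟨r, hr⟩ := hex 2
  have hpq : p ≠ q := by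
    rintro rfl
    exact hq (B 1 1 0 p (by decide) (by decide) hp)
  have hpr : p ≠ r := by
    rintro rfl
    exact hr (B 2 2 0 p (by decide) (by decide) hp)
  have hqr : q ≠ r := by
    rintro rfl
    exact hr (B 2 2 1 q (by decide) (by decide) hq)
  obtain ⟨⟨a1, a2, a3⟩, ⟨a4, a5, a6⟩, ⟨a7, a8, a9⟩, ⟨b1, b2⟩, ⟨b3, b4⟩, b5, b6⟩ :=
    key_facts P hsum B p q r hpq hpr hqr hp hq hr
  have hVx : ∀ x k, V x k = P 0 0 k * x 0 ^ 2 + P 1 1 k * x 1 ^ 2 + P 2 2 k * x 2 ^ 2 +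
      2 * P 0 1 k * x 0 * x 1 + 2 * P 0 2 k * x 0 * x 2 + 2 * P 1 2 k * x 1 * x 2 := by
    intro x k
    rw [hV]
    simp only [Fin.sum_univ_three]
    rw [hPsym 1 0 k, hPsym 2 0 k, hPsym 2 1 k]
    ring
  clear hp hq hr hV hOP B hex hsum
  have hcases : (p = 2 ∧ q = 1 ∧ r = 0) ∨ (p = 0 ∧ q = 1 ∧ r = 2) ∨ (p = 0 ∧ q = 2 ∧ r = 1) ∨
      (p = 2 ∧ q = 0 ∧ r = 1) ∨ (p = 1 ∧ q = 0 ∧ r = 2) ∨ (p = 1 ∧ q = 2 ∧ r = 0) := by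
    clear * - hpq hpr hqr
    revert p q r
    decide
  rcases hcases with ⟨rfl, rfl, rfl⟩ | ⟨rfl, rfl, rfl⟩ | ⟨rfl, rfl, rfl⟩ | ⟨rfl, rfl, rfl⟩ |
    ⟨rfl, rfl, rfl⟩ | ⟨rfl, rfl, rfl⟩
  · refine ⟨P 0 1 1, P 1 2 0, P 0 2 0, hle _ _ _, hle _ _ _, hle _ _ _, Or.inl ?_⟩
    intro x _
    ext k
    rw [hVx]
    fin_cases k <;> simp [V1, a1, a2, a3, a4, a5, a6, a7, a8, a9, b1, b2, b3, b4, b5, b6] <;> ring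
  · refine ⟨P 0 1 0, P 1 2 1, P 0 2 0, hle _ _ _, hle _ _ _, hle _ _ _, Or.inr (Or.inl ?_)⟩
    intro x _
    ext k
    rw [hVx]
    fin_cases k <;> simp [V2, a1, a2, a3, a4, a5, a6, a7, a8, a9, b1, b2, b3, b4, b5, b6] <;> ring
  · refine ⟨P 0 1 0, P 1 2 1, P 0 2 0, hle _ _ _, hle _ _ _, hle _ _ _, Or.inr (Or.inr (Or.inl ?_))⟩
    intro x _
    ext k
    rw [hVx]
    fin_cases k <;> simp [V3, a1, a2, a3, a4, a5, a6, a7, a8, a9, b1, b2, b3, b4, b5, b6] <;> ring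
  · refine ⟨P 0 1 0, P 1 2 0, P 0 2 1, hle _ _ _, hle _ _ _, hle _ _ _, Or.inr (Or.inr (Or.inr (Or.inl ?_)))⟩
    intro x _
    ext k
    rw [hVx]
    fin_cases k <;> simp [V4, a1, a2, a3, a4, a5, a6, a7, a8, a9, b1, b2, b3, b4, b5, b6] <;> ring
  · refine ⟨P 0 1 0, P 1 2 0, P 0 2 1, hle _ _ _, hle _ _ _, hle _ _ _, Or.inr (Or.inr (Or.inr (Or.inr (Or.inl ?_))))⟩
    intro x _
    ext k
    rw [hVx]
    fin_cases k <;> simp [V5, a1, a2, a3, a4, a5, a6, a7, a8, a9, b1, b2, b3, b4, b5, b6] <;> ring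
  · refine ⟨P 0 1 1, P 1 2 0, P 0 2 0, hle _ _ _, hle _ _ _, hle _ _ _, Or.inr (Or.inr (Or.inr (Or.inr (Or.inr ?_))))⟩
    intro x _
    ext k
    rw [hVx]
    fin_cases k <;> simp [V6, a1, a2, a3, a4, a5, a6, a7, a8, a9, b1, b2, b3, b4, b5, b6] <;> ring
end

section
/- For all α, β, γ ∈ [0,1] and each i ∈ {1,…,6}, the operator V^{(i)}_{α,β,γ} : S² → S² is orthogonal preserving: whenever x, y ∈ S² satisfy x ⊥ y, one has V^{(i)}_{α,β,γ}(x) ⊥ V^{(i)}_{α,β,γ}(y). -/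
open Finset

/-- If each coordinate of `W` is divisible by a coordinate of the argument,
then `W` preserves disjointness of supports. -/
theorem orth_of_factor (W : (Fin 3 → ℝ) → Fin 3 → ℝ) (s : Fin 3 → Fin 3)
    (h : ∀ i p, p (s i) = 0 → W p i = 0) (x y : Fin 3 → ℝ) (hxy : Orth x y) :
    Orth (W x) (W y) := by
  refine Set.eq_empty_iff_forall_notMem.2 ?_
  rintro i ⟨h1, h2⟩
  refine Set.eq_empty_iff_forall_notMem.1 hxy (s i) ⟨?_, ?_⟩
  · exact fun h0 => h1 (h i x h0)
  · exact fun h0 => h2 (h i y h0)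

/-- For all `α, β, γ ∈ [0,1]`, each of the six operators
`V⁽¹⁾_{α,β,γ}, …, V⁽⁶⁾_{α,β,γ}` is orthogonal preserving on `S²`: whenever
`x, y ∈ S²` have disjoint supports, so do their images. -/
theorem six_operators_orthogonal_preserving
    (a b g : ℝ) (ha : a ∈ Set.Icc (0 : ℝ) 1) (hb : b ∈ Set.Icc (0 : ℝ) 1)
    (hg : g ∈ Set.Icc (0 : ℝ) 1) :
    ∀ W ∈ [V1 a b g, V2 a b g, V3 a b g, V4 a b g, V5 a b g, V6 a b g],
      ∀ x ∈ S2, ∀ y ∈ S2, Orth x y → Orth (W x) (W y) := by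
  intro W hW x _ y _ hxy
  simp only [List.mem_cons, List.not_mem_nil, or_false] at hW
  rcases hW with rfl | rfl | rfl | rfl | rfl | rfl
  · refine orth_of_factor _ ![2, 1, 0] (fun i p hp => ?_) x y hxy
    fin_cases i <;> simp at hp <;> simp [V1, hp]
  · refine orth_of_factor _ ![0, 1, 2] (fun i p hp => ?_) x y hxy
    fin_cases i <;> simp at hp <;> simp [V2, hp]
  · refine orth_of_factor _ ![0, 2, 1] (fun i p hp => ?_) x y hxy
    fin_cases i <;> simp at hp <;> simp [V3, hp]
  · refine orth_of_factor _ ![1, 2, 0] (fun i p hp => ?_) x y hxy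
    fin_cases i <;> simp at hp <;> simp [V4, hp]
  · refine orth_of_factor _ ![1, 0, 2] (fun i p hp => ?_) x y hxy
    fin_cases i <;> simp at hp <;> simp [V5, hp]
  · refine orth_of_factor _ ![2, 0, 1] (fun i p hp => ?_) x y hxy
    fin_cases i <;> simp at hp <;> simp [V6, hp]
end

section
/- For every α, β, γ ∈ [0,1], the bilinear multiplication on ℝ³ associated with the operator V^{(1)}_{α,β,γ}, namely (x∘y)₁ = x₃y₃ + γ(x₁y₃ + x₃y₁) + β(x₂y₃ + x₃y₂), (x∘y)₂ = x₂y₂ + α(x₁y₂ + x₂y₁) + (1−β)(x₂y₃ + x₃y₂), (x∘y)₃ = x₁y₁ + (1−α)(x₁y₂ + x₂y₁) + (1−γ)(x₁y₃ + x₃y₁), is not associative: there exist x, y, z ∈ ℝ³ with (x∘y)∘z ≠ x∘(y∘z). -/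
/-- The bilinear multiplication on `ℝ³` associated with the operator `V⁽¹⁾_{α,β,γ}`. -/
noncomputable def mul1 (a b g : ℝ) (u v : Fin 3 → ℝ) : Fin 3 → ℝ :=
  ![u 2 * v 2 + g * (u 0 * v 2 + u 2 * v 0) + b * (u 1 * v 2 + u 2 * v 1),
    u 1 * v 1 + a * (u 0 * v 1 + u 1 * v 0) + (1 - b) * (u 1 * v 2 + u 2 * v 1),
    u 0 * v 0 + (1 - a) * (u 0 * v 1 + u 1 * v 0) + (1 - g) * (u 0 * v 2 + u 2 * v 0)]

/-- For every `α, β, γ ∈ [0,1]`, the multiplication associated with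
`V⁽¹⁾_{α,β,γ}` is not associative: there exist `x, y, z ∈ ℝ³` with
`(x ∘ y) ∘ z ≠ x ∘ (y ∘ z)`. -/
theorem mul1_not_associative
    (a b g : ℝ) (ha : a ∈ Set.Icc (0 : ℝ) 1) (hb : b ∈ Set.Icc (0 : ℝ) 1)
    (hg : g ∈ Set.Icc (0 : ℝ) 1) :
    ∃ u v w : Fin 3 → ℝ, mul1 a b g (mul1 a b g u v) w ≠ mul1 a b g u (mul1 a b g v w) := by
  refine ⟨![1, 0, 0], ![1, 0, 0], ![0, 0, 1], fun h => ?_⟩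
  have h0 := congrFun h 0
  simp [mul1] at h0
  nlinarith [sq_nonneg (g - 1 / 2)]
end

section
/- For every α, β, γ ∈ [0,1], the bilinear multiplication on ℝ³ associated with the operator V^{(4)}_{α,β,γ}, namely (x∘y)₁ = x₂y₂ + α(x₁y₂ + x₂y₁) + β(x₂y₃ + x₃y₂), (x∘y)₂ = x₃y₃ + γ(x₁y₃ + x₃y₁) + (1−β)(x₂y₃ + x₃y₂), (x∘y)₃ = x₁y₁ + (1−α)(x₁y₂ + x₂y₁) + (1−γ)(x₁y₃ + x₃y₁), is not associative: there exist x, y, z ∈ ℝ³ with (x∘y)∘z ≠ x∘(y∘z). -/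
/-- The bilinear multiplication on `ℝ³` associated with the operator `V⁽⁴⁾_{α,β,γ}`. -/
noncomputable def mul4 (a b g : ℝ) (u v : Fin 3 → ℝ) : Fin 3 → ℝ :=
  ![u 1 * v 1 + a * (u 0 * v 1 + u 1 * v 0) + b * (u 1 * v 2 + u 2 * v 1),
    u 2 * v 2 + g * (u 0 * v 2 + u 2 * v 0) + (1 - b) * (u 1 * v 2 + u 2 * v 1),
    u 0 * v 0 + (1 - a) * (u 0 * v 1 + u 1 * v 0) + (1 - g) * (u 0 * v 2 + u 2 * v 0)]

/-- For every `α, β, γ ∈ [0,1]`, the multiplication associated with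
`V⁽⁴⁾_{α,β,γ}` is not associative: there exist `x, y, z ∈ ℝ³` with
`(x ∘ y) ∘ z ≠ x ∘ (y ∘ z)`. -/
theorem mul4_not_associative
    (a b g : ℝ) (ha : a ∈ Set.Icc (0 : ℝ) 1) (hb : b ∈ Set.Icc (0 : ℝ) 1)
    (hg : g ∈ Set.Icc (0 : ℝ) 1) :
    ∃ u v w : Fin 3 → ℝ, mul4 a b g (mul4 a b g u v) w ≠ mul4 a b g u (mul4 a b g v w) := by
  by_contra! h
  have h1 := congrFun (h ![1, 0, 0] ![1, 0, 0] ![0, 1, 0]) 0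
  have h2 := congrFun (h ![0, 1, 0] ![0, 1, 0] ![0, 0, 1]) 0
  simp [mul4] at h1 h2
  subst h1
  norm_num at h2
end
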